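/- Let s and sΔ be vectors in a real inner product space with s ≠ 0, and suppose there exist a scalar α > 0, vectors Δ₁, Δ₂, and constants ε, τ ≥ 0 with r := ε + τ < 1 such that sΔ = α s + Δ₁ + Δ₂, ‖Δ₁‖ ≤ ε α ‖s‖, and ‖Δ₂‖ ≤ τ α ‖s‖. Then the cosine similarity satisfies ⟪s, sΔ⟫ / (‖s‖ ‖sΔ‖) ≥ (1 − r)/(1 + r). -/

import Mathlib

open RealInnerProductSpace

theorem cosine_similarity_lower_bound
    {E : Type*} [NormedAddCommGroup E] [InnerProductSpace ℝ E]
    (s sΔ Δ₁ Δ₂ : E) (α ε τ : ℝ)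
    (hs : s ≠ 0) (hα : 0 < α) (hε : 0 ≤ ε) (hτ : 0 ≤ τ) (hr : ε + τ < 1)
    (hdecomp : sΔ = α • s + Δ₁ + Δ₂)
    (h1 : ‖Δ₁‖ ≤ ε * α * ‖s‖) (h2 : ‖Δ₂‖ ≤ τ * α * ‖s‖) :
    (1 - (ε + τ)) / (1 + (ε + τ)) ≤ ⟪s, sΔ⟫ / (‖s‖ * ‖sΔ‖) := by
  have hs' : 0 < ‖s‖ := norm_pos_iff.mpr hs
  have hr' : 0 < 1 - (ε + τ) := by linarith
  have hinner : (1 - (ε + τ)) * (α * ‖s‖ ^ 2) ≤ ⟪s, sΔ⟫ := by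
    have hi₁ := (abs_le.mp (abs_real_inner_le_norm s Δ₁)).1
    have hi₂ := (abs_le.mp (abs_real_inner_le_norm s Δ₂)).1
    have hm₁ := mul_le_mul_of_nonneg_left h1 hs'.le
    have hm₂ := mul_le_mul_of_nonneg_left h2 hs'.le
    rw [hdecomp, inner_add_right, inner_add_right, real_inner_smul_right,
      real_inner_self_eq_norm_sq]
    linarith
  have hnorm : ‖sΔ‖ ≤ (1 + (ε + τ)) * (α * ‖s‖) := by
    have h := norm_add₃_le (a := α • s) (b := Δ₁) (c := Δ₂)
    rw [norm_smul, Real.norm_of_nonneg hα.le, ← hdecomp] at h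
    linarith
  have hpos : 0 < ⟪s, sΔ⟫ := lt_of_lt_of_le (by positivity) hinner
  have hΔ : 0 < ‖sΔ‖ := by
    refine norm_pos_iff.mpr fun h => ?_
    simp [h] at hpos
  rw [div_le_div_iff₀ (by positivity) (by positivity)]
  calc (1 - (ε + τ)) * (‖s‖ * ‖sΔ‖)
      ≤ (1 - (ε + τ)) * (‖s‖ * ((1 + (ε + τ)) * (α * ‖s‖))) := by gcongr
    _ = (1 - (ε + τ)) * (α * ‖s‖ ^ 2) * (1 + (ε + τ)) := by ring
    _ ≤ ⟪s, sΔ⟫ * (1 + (ε + τ)) := by gcongr
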